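/- Suppose W is the full group of permutations of {1,…,r₀} commuting with ι (the case G ≠ SO(2r)). Let w ∈ W be in reduced form (hence in standard form) and satisfy Hypothesis (L). Then there exist n₁ with 0 ≤ n₁ < n and elements k_1, …, k_{n−n₁} of {ℓ+1, ℓ+2, …, (ℓ+1)'} (= {ℓ+1,…,r₀−ℓ}), with the transpositions below pairwise disjoint, such that w = (1 r₀)(2 r₀−1)⋯(n₁ n₁')·(n₁+1 k_1)(k_1' (n₁+1)')⋯(n k_{n−n₁})(k_{n−n₁}' n'); moreover k_j = (ℓ+1)' for some j. -/

import Mathlib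

/-!  Common framework: Weyl groups of classical groups, modeled as permutations of ℕ
supported on `{1,…,r₀}`, with the convention `i' = r₀ + 1 - i`. -/

/-- `IsWfull r₀ w`: `w` fixes every point outside `{1,…,r₀}` and commutes with the
involution `ι : i ↦ r₀ + 1 - i` on `{1,…,r₀}`.  This is the full group of permutations
of `{1,…,r₀}` commuting with `ι` (the Weyl group of `SO(2r+1)`, `U(2r+1)` or `U(2r)`). -/
def IsWfull (r₀ : ℕ) (w : Equiv.Perm ℕ) : Prop :=
  (∀ i : ℕ, ¬(1 ≤ i ∧ i ≤ r₀) → w i = i) ∧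
  (∀ i : ℕ, 1 ≤ i → i ≤ r₀ → w (r₀ + 1 - i) = r₀ + 1 - w i)

/-- The parity condition singling out the Weyl group of `SO(2r)`:
the number of indices `1 ≤ i ≤ r` with `w i > r` is even. -/
def EvenCond (r : ℕ) (w : Equiv.Perm ℕ) : Prop :=
  Even (((Finset.Icc 1 r).filter (fun i => r < w i)).card)

/-- Membership in `W`; the proposition `so2r` indicates whether we are in the `SO(2r)`
case (where the parity condition is imposed on top of `IsWfull`). -/
def MemW (r r₀ : ℕ) (so2r : Prop) (w : Equiv.Perm ℕ) : Prop :=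
  IsWfull r₀ w ∧ (so2r → EvenCond r w)

/-- Membership in `W_M`: an element of `W` with `w({1,…,n}) = {1,…,n}` and
`w({n+1,…,r₀−n}) = {n+1,…,r₀−n}`. -/
def MemWM (r r₀ n : ℕ) (so2r : Prop) (m : Equiv.Perm ℕ) : Prop :=
  MemW r r₀ so2r m ∧
  (Finset.Icc 1 n).image (fun i => m i) = Finset.Icc 1 n ∧
  (Finset.Icc (n + 1) (r₀ - n)).image (fun i => m i) = Finset.Icc (n + 1) (r₀ - n)

/-- The left coset `w·{m | P m}`. -/
def coset (P : Equiv.Perm ℕ → Prop) (w : Equiv.Perm ℕ) : Set (Equiv.Perm ℕ) :=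
  {x | ∃ m, P m ∧ x = w * m}

/-- `w` is in standard form: a product of pairwise disjoint transpositions
`∏ᵢ (aᵢ aᵢ') · ∏ᵢ (bᵢ cᵢ)(cᵢ' bᵢ')` with `aᵢ, bᵢ ∈ {1,…,n}` and `cᵢ ∈ {n+1,…,r₀−n}`.
This is encoded pointwise: `w` belongs to the full group `W`, is an involution, every
moved point `i ∈ {1,…,n}` has `w i = i'` or `w i ∈ {n+1,…,r₀−n}`, and every moved
point `i ∈ {n+1,…,r₀−n}` has `w i ∈ {1,…,n}` or `w i ∈ {n',…,r₀}`. -/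
def IsStandardForm (r₀ n : ℕ) (w : Equiv.Perm ℕ) : Prop :=
  IsWfull r₀ w ∧ w * w = 1 ∧
  (∀ i, 1 ≤ i → i ≤ n → w i ≠ i →
    (w i = r₀ + 1 - i ∨ (n + 1 ≤ w i ∧ w i ≤ r₀ - n))) ∧
  (∀ i, n + 1 ≤ i → i ≤ r₀ - n → w i ≠ i →
    (w i ≤ n ∨ r₀ + 1 - n ≤ w i))

/-- The 4-cycle `(a b c d)` sending `a ↦ b ↦ c ↦ d ↦ a`. -/
def cycle4 (a b c d : ℕ) : Equiv.Perm ℕ :=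
  Equiv.swap a b * Equiv.swap b c * Equiv.swap c d

/-- `w` is in reduced form: `w = w₁ w₂` with `w₁` in standard form, `w₂` disjoint from
`w₁`, and `w₂` either the identity, or (only in the `SO(2r)` case) a transposition
`(d₀ d₀')` with `n+1 ≤ d₀ ≤ r`, or a 4-cycle `(i₀ j₀' i₀' j₀)` with `1 ≤ i₀ ≤ n < j₀ ≤ r`. -/
def IsReducedForm (r r₀ n : ℕ) (so2r : Prop) (w : Equiv.Perm ℕ) : Prop :=
  ∃ w₁ w₂ : Equiv.Perm ℕ,
    IsStandardForm r₀ n w₁ ∧ w = w₁ * w₂ ∧ Equiv.Perm.Disjoint w₁ w₂ ∧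
    (w₂ = 1 ∨
      (so2r ∧
        ((∃ d₀, n + 1 ≤ d₀ ∧ d₀ ≤ r ∧ w₂ = Equiv.swap d₀ (r₀ + 1 - d₀)) ∨
         (∃ i₀ j₀, 1 ≤ i₀ ∧ i₀ ≤ n ∧ n < j₀ ∧ j₀ ≤ r ∧
            w₂ = cycle4 i₀ (r₀ + 1 - j₀) (r₀ + 1 - i₀) j₀))))

/-- The vector `e_i : {1,…,r₀} → ℤ` with `e_i(i) = 1`, `e_i(i') = −1`, `0` elsewhere. -/
def evec (r₀ i : ℕ) : ℕ → ℤ :=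
  fun k => if k = i then 1 else if k = r₀ + 1 - i then -1 else 0

/-- The simple root `α_i = e_i − e_{i+1}`. -/
def rootAlpha (r₀ i : ℕ) : ℕ → ℤ := evec r₀ i - evec r₀ (i + 1)

/-- The root `β = e_ℓ + e_{ℓ+1}`. -/
def rootBeta (r₀ l : ℕ) : ℕ → ℤ := evec r₀ l + evec r₀ (l + 1)

/-- The action of `w` on root vectors: `(w·v)(k) = v(w⁻¹ k)`. -/
def pact (w : Equiv.Perm ℕ) (v : ℕ → ℤ) : ℕ → ℤ := fun k => v (w⁻¹ k)

/-- The set `X = {α_1,…,α_ℓ, β}`. -/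
def Xset (r₀ l : ℕ) : Set (ℕ → ℤ) :=
  {v | (∃ i, 1 ≤ i ∧ i ≤ l ∧ v = rootAlpha r₀ i) ∨ v = rootBeta r₀ l}

/-- The set of short and long roots `{e_i, 2e_i : 1 ≤ i ≤ n}` from which `S₀` is drawn. -/
def ShortLong (r₀ n : ℕ) : Set (ℕ → ℤ) :=
  {v | ∃ i, 1 ≤ i ∧ i ≤ n ∧ (v = evec r₀ i ∨ v = evec r₀ i + evec r₀ i)}

/-- `Σ_P^+ = {e_i ± e_j : 1 ≤ i ≤ n < j ≤ r} ∪ {e_i + e_j : 1 ≤ i < j ≤ n} ∪ S₀`. -/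
def SigmaP (r r₀ n : ℕ) (S₀ : Set (ℕ → ℤ)) : Set (ℕ → ℤ) :=
  {v | ∃ i j, 1 ≤ i ∧ i ≤ n ∧ n < j ∧ j ≤ r ∧
        (v = evec r₀ i - evec r₀ j ∨ v = evec r₀ i + evec r₀ j)} ∪
  {v | ∃ i j, 1 ≤ i ∧ i < j ∧ j ≤ n ∧ v = evec r₀ i + evec r₀ j} ∪ S₀

/-- Hypothesis (E): `w·α ∉ X` for every `α ∈ Σ_P^+`. -/
def HypE (r r₀ n l : ℕ) (S₀ : Set (ℕ → ℤ)) (w : Equiv.Perm ℕ) : Prop :=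
  ∀ α ∈ SigmaP r r₀ n S₀, pact w α ∉ Xset r₀ l

/-- Hypothesis (L): `α_ℓ = w·α` for some `α ∈ Σ_P^+`; no other element of `X` is of the
form `w·α` with `α ∈ Σ_P^+`; and `w⁻¹·α_ℓ` is not of the form `e_i + e_j` with
`1 ≤ i, j ≤ n`. -/
def HypL (r r₀ n l : ℕ) (S₀ : Set (ℕ → ℤ)) (w : Equiv.Perm ℕ) : Prop :=
  (∃ α ∈ SigmaP r r₀ n S₀, pact w α = rootAlpha r₀ l) ∧
  (∀ α ∈ SigmaP r r₀ n S₀, pact w α ∈ Xset r₀ l → pact w α = rootAlpha r₀ l) ∧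
  ¬ ∃ i j, 1 ≤ i ∧ i ≤ n ∧ 1 ≤ j ∧ j ≤ n ∧
      pact w⁻¹ (rootAlpha r₀ l) = evec r₀ i + evec r₀ j

/-- The permutation `(1 r₀)(2 r₀−1)⋯(n n')`. -/
def w0base (r₀ n : ℕ) : Equiv.Perm ℕ :=
  (((List.range n).map (fun i => Equiv.swap (i + 1) (r₀ - i))).prod)

/-- A product of permutations `f j` agreeing with `w` on pairwise disjoint `w`-invariant sets `A j`
and trivial elsewhere agrees with `w` on the union of the `A j` and is trivial elsewhere. -/
lemma prod_range_apply (w : Equiv.Perm ℕ) (f : ℕ → Equiv.Perm ℕ) (A : ℕ → ℕ → Prop) (m : ℕ)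
    (hon : ∀ j < m, ∀ x, A j x → f j x = w x) (hoff : ∀ j < m, ∀ x, ¬ A j x → f j x = x)
    (hinv : ∀ j < m, ∀ x, A j x → A j (w x))
    (hdis : ∀ i < m, ∀ j < m, ∀ x, A i x → A j x → i = j) :
    (∀ x, (∃ j < m, A j x) → ((List.range m).map f).prod x = w x) ∧
      (∀ x, (¬ ∃ j < m, A j x) → ((List.range m).map f).prod x = x) := by
  induction m with
  | zero => simp
  | succ m ih =>
    obtain ⟨ih₁, ih₂⟩ := ih (fun j hj => hon j (by omega)) (fun j hj => hoff j (by omega))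
      (fun j hj => hinv j (by omega)) (fun i hi j hj => hdis i (by omega) j (by omega))
    simp only [List.range_succ, List.map_append, List.prod_append, List.map_cons, List.map_nil,
      List.prod_cons, List.prod_nil, mul_one, Equiv.Perm.mul_apply]
    refine ⟨fun x hx => ?_, fun x hx => ?_⟩
    · by_cases hm : A m x
      · rw [hon m (by omega) x hm]
        refine ih₂ _ ?_
        rintro ⟨j, hj, hjx⟩
        have := hdis j (by omega) m (by omega) _ hjx (hinv m (by omega) x hm)
        omega
      · rw [hoff m (by omega) x hm]
        obtain ⟨j, hj, hjx⟩ := hx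
        have hjm : j ≠ m := by rintro rfl; exact hm hjx
        exact ih₁ x ⟨j, by omega, hjx⟩
    · rw [hoff m (by omega) x fun h => hx ⟨m, by omega, h⟩]
      exact ih₂ x fun ⟨j, hj, h⟩ => hx ⟨j, by omega, h⟩

lemma evec_dual {r₀ b : ℕ} (hb₂ : b ≤ r₀) (hb : 2 * b ≠ r₀ + 1) :
    evec r₀ (r₀ + 1 - b) = -evec r₀ b := by
  funext k
  simp only [evec, Pi.neg_apply]
  split_ifs <;> omega

lemma IsWfull.mem_range {r₀ : ℕ} {w : Equiv.Perm ℕ} (hw : IsWfull r₀ w) {i : ℕ}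
    (h₁ : 1 ≤ i) (h₂ : i ≤ r₀) : 1 ≤ w i ∧ w i ≤ r₀ := by
  by_contra h
  have := w.injective (hw.1 _ h)
  rw [this] at h
  exact h ⟨h₁, h₂⟩

lemma pact_evec {r₀ : ℕ} {w : Equiv.Perm ℕ} (hw : IsWfull r₀ w) {i : ℕ}
    (h₁ : 1 ≤ i) (h₂ : i ≤ r₀) : pact w (evec r₀ i) = evec r₀ (w i) := by
  funext k
  simp only [pact, evec, Equiv.Perm.inv_eq_iff_eq]
  rw [hw.2 i h₁ h₂]

lemma evec_sub_mem_SigmaP {r r₀ n a b : ℕ} (S₀ : Set (ℕ → ℤ))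
    (hr₀ : r₀ = 2 * r ∨ r₀ = 2 * r + 1) (hnr : n < r) (ha : 1 ≤ a) (hb : b ≤ r₀)
    (ha' : 2 * a ≠ r₀ + 1) (hb' : 2 * b ≠ r₀ + 1) (hab : a + b ≠ r₀ + 1)
    (h : (a ≤ n ∧ n < b) ∨ (a ≤ r₀ - n ∧ r₀ - n < b)) :
    evec r₀ a - evec r₀ b ∈ SigmaP r r₀ n S₀ := by
  left
  have da : a ≤ r₀ → evec r₀ (r₀ + 1 - a) = -evec r₀ a := fun h => evec_dual h ha'
  have db := evec_dual hb hb'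
  by_cases h1 : a ≤ n
  · by_cases h2 : b ≤ r₀ - n
    · left
      by_cases h3 : b ≤ r
      · exact ⟨a, b, ha, h1, by omega, h3, Or.inl rfl⟩
      · exact ⟨a, r₀ + 1 - b, ha, h1, by omega, by omega, Or.inr (by rw [db]; abel)⟩
    · right
      rcases lt_or_ge a (r₀ + 1 - b) with h3 | h3
      · exact ⟨a, r₀ + 1 - b, ha, h3, by omega, by rw [db]; abel⟩
      · exact ⟨r₀ + 1 - b, a, by omega, by omega, h1, by rw [db]; abel⟩
  · left
    have da := da (by omega)
    by_cases h3 : a ≤ r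
    · exact ⟨r₀ + 1 - b, a, by omega, by omega, by omega, h3, Or.inr (by rw [db]; abel)⟩
    · exact ⟨r₀ + 1 - b, r₀ + 1 - a, by omega, by omega, by omega, by omega,
        Or.inl (by rw [da, db]; abel)⟩

/-- Up to the symmetry `(a, b) ↦ (b', a')`, a root `e_a - e_b` determines `a` and `b`. -/
lemma eq_or_eq_of_evec_sub_eq {r₀ l a b : ℕ} (hl : 1 ≤ l) (hlr : 2 * l + 2 ≤ r₀) (ha₁ : 1 ≤ a)
    (ha₂ : a ≤ r₀) (hb₂ : b ≤ r₀)
    (h : evec r₀ a - evec r₀ b = rootAlpha r₀ l) :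
    (a = l ∧ b = l + 1) ∨ (a = r₀ - l ∧ b = r₀ + 1 - l) := by
  have h₁ := congrFun h l
  have h₂ := congrFun h (l + 1)
  simp only [rootAlpha, evec, Pi.sub_apply] at h₁ h₂
  grind (splits := 20)

/-- The position of `w⁻¹ · α_ℓ` under Hypothesis (L). -/
lemma HypL.apply_cases {r n ℓ r₀ : ℕ} (hn : 1 ≤ n) (hnl : n ≤ ℓ) (hlr : ℓ + 1 ≤ r)
    (hr₀ : r₀ = 2 * r ∨ r₀ = 2 * r + 1) {S₀ : Set (ℕ → ℤ)} (hS₀ : S₀ ⊆ ShortLong r₀ n)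
    {w : Equiv.Perm ℕ} (hw : IsWfull r₀ w) (hL : HypL r r₀ n ℓ S₀ w) :
    ∃ i j, 1 ≤ i ∧ i ≤ n ∧ n < j ∧ j ≤ r₀ - n ∧
      ((w i = ℓ ∧ w j = ℓ + 1) ∨ (w i = r₀ - ℓ ∧ w j = ℓ)) := by
  obtain ⟨⟨α, hα, hαw⟩, -, hL₃⟩ := hL
  rcases hα with (⟨i, j, hi, hin, hj, hjr, rfl | rfl⟩ | ⟨i, j, hi, hij, hj, rfl⟩) | hα
  · have e : pact w (evec r₀ i - evec r₀ j) = evec r₀ (w i) - evec r₀ (w j) := by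
      rw [← pact_evec hw hi (by omega), ← pact_evec hw (by omega) (by omega)]; rfl
    rw [e] at hαw
    have ri := hw.mem_range (i := i) (by omega) (by omega)
    have rj := hw.mem_range (i := j) (by omega) (by omega)
    rcases eq_or_eq_of_evec_sub_eq (by omega) (by omega) ri.1 ri.2 rj.2 hαw with h | h
    · exact ⟨i, j, hi, hin, hj, by omega, Or.inl h⟩
    · refine ⟨i, r₀ + 1 - j, hi, hin, by omega, by omega, Or.inr ⟨h.1, ?_⟩⟩
      rw [hw.2 j (by omega) (by omega)]; omega
  · have ri := hw.mem_range (i := i) (by omega) (by omega)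
    have rj := hw.mem_range (i := r₀ + 1 - j) (by omega) (by omega)
    have e : pact w (evec r₀ i + evec r₀ j) =
        evec r₀ (w i) - evec r₀ (w (r₀ + 1 - j)) := by
      rw [← pact_evec hw hi (by omega), ← pact_evec hw (by omega) (by omega),
        evec_dual (by omega) (by omega)]
      funext k
      simp [pact]
    rw [e] at hαw
    rcases eq_or_eq_of_evec_sub_eq (by omega) (by omega) ri.1 ri.2 rj.2 hαw with h | h
    · exact ⟨i, r₀ + 1 - j, hi, hin, by omega, by omega, Or.inl h⟩
    · refine ⟨i, j, hi, hin, by omega, by omega, Or.inr ⟨h.1, ?_⟩⟩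
      have := h.2
      have := hw.mem_range (i := j) (by omega) (by omega)
      rw [hw.2 j (by omega) (by omega)] at h
      omega
  · refine absurd ⟨i, j, hi, by omega, by omega, hj, ?_⟩ hL₃
    rw [← hαw]
    funext k
    simp [pact]
  · exfalso
    obtain ⟨i, hi, hin, h⟩ := hS₀ hα
    have ri := hw.mem_range (i := i) (by omega) (by omega)
    have e := pact_evec hw hi (by omega)
    have e₂ : pact w (evec r₀ i + evec r₀ i) = evec r₀ (w i) + evec r₀ (w i) := by
      rw [← e]; rfl
    have h₁ := congrFun hαw ℓ
    have h₂ := congrFun hαw (ℓ + 1)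
    rcases h with rfl | rfl
    · rw [e] at h₁ h₂
      simp only [rootAlpha, evec, Pi.sub_apply] at h₁ h₂
      grind
    · rw [e₂] at h₁ h₂
      simp only [rootAlpha, evec, Pi.sub_apply, Pi.add_apply] at h₁ h₂
      grind

/-- Under Hypothesis (L), `w⁻¹` does not send an element `e_p - e_q ≠ α_ℓ` of `X` into `Σ_P^+`. -/
lemma HypL.not_block_lt {r n ℓ r₀ : ℕ} (hnr : n < r)
    (hr₀ : r₀ = 2 * r ∨ r₀ = 2 * r + 1) {S₀ : Set (ℕ → ℤ)}
    {w : Equiv.Perm ℕ} (hw : IsWfull r₀ w) (hww : ∀ x, w (w x) = x)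
    (hL : HypL r r₀ n ℓ S₀ w) {p q : ℕ} (hp₁ : 1 ≤ p) (hp₂ : p ≤ r₀) (hq₁ : 1 ≤ q) (hq₂ : q ≤ r₀)
    (hp : 2 * p ≠ r₀ + 1) (hq : 2 * q ≠ r₀ + 1) (hpq : p + q ≠ r₀ + 1)
    (hX : evec r₀ p - evec r₀ q ∈ Xset r₀ ℓ) (hne : evec r₀ p - evec r₀ q ≠ rootAlpha r₀ ℓ) :
    ¬ ((w p ≤ n ∧ n < w q) ∨ (w p ≤ r₀ - n ∧ r₀ - n < w q)) := by
  intro h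
  have rp := hw.mem_range hp₁ hp₂
  have rq := hw.mem_range hq₁ hq₂
  have inj : ∀ a b, w a = w b → a = b := fun a b h => w.injective h
  have dp := hw.2 p hp₁ hp₂
  have dq := hw.2 q hq₁ hq₂
  have hmem := evec_sub_mem_SigmaP S₀ hr₀ hnr rp.1 rq.2
    (fun h => by have := inj (r₀ + 1 - p) p (by omega); omega)
    (fun h => by have := inj (r₀ + 1 - q) q (by omega); omega)
    (fun h => by have := inj (r₀ + 1 - q) p (by omega); omega) h
  have e : pact w (evec r₀ (w p) - evec r₀ (w q)) = evec r₀ p - evec r₀ q := by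
    conv_rhs => rw [← hww p, ← hww q]
    rw [← pact_evec hw rp.1 rp.2, ← pact_evec hw rq.1 rq.2]; rfl
  have := hL.2.1 _ hmem
  rw [e] at this
  exact hne (this hX)

/-- The values on `{1,…,ℓ}` of an involution in standard form satisfying Hypothesis (L). -/
lemma HypL.structure_of_isStandardForm {r n ℓ r₀ : ℕ} (hn : 1 ≤ n) (hnl : n ≤ ℓ)
    (hlr : ℓ + 1 ≤ r) (hr₀ : r₀ = 2 * r ∨ r₀ = 2 * r + 1) {S₀ : Set (ℕ → ℤ)}
    (hS₀ : S₀ ⊆ ShortLong r₀ n) {w : Equiv.Perm ℕ} (hst : IsStandardForm r₀ n w)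
    (hL : HypL r r₀ n ℓ S₀ w) :
    ∃ n₁ < n, (∀ i, 1 ≤ i → i ≤ n₁ → w i = r₀ + 1 - i) ∧
      (∀ i, n₁ < i → i ≤ n → ℓ + 1 ≤ w i ∧ w i ≤ r₀ - ℓ) ∧
      ∃ i, n₁ < i ∧ i ≤ n ∧ w i = r₀ - ℓ := by
  obtain ⟨hw, hsq, hlow, hmid⟩ := hst
  have hww : ∀ x, w (w x) = x := fun x => by
    rw [← Equiv.Perm.mul_apply, hsq, Equiv.Perm.one_apply]
  have hmono : ∀ i, 1 ≤ i → i < ℓ →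
      ¬ ((w i ≤ n ∧ n < w (i + 1)) ∨ (w i ≤ r₀ - n ∧ r₀ - n < w (i + 1))) := by
    intro i hi hil
    refine hL.not_block_lt (by omega) hr₀ hw hww hi (by omega) (by omega) (by omega) (by omega)
      (by omega) (by omega) (Or.inl ⟨i, hi, hil.le, rfl⟩) fun h => ?_
    have := congrFun h i
    simp only [rootAlpha, evec, Pi.sub_apply] at this
    grind
  obtain ⟨i₀, j₀, hi, hin, hj, hjn, ⟨h1, h2⟩ | ⟨h1, h2⟩⟩ :=
    hL.apply_cases hn hnl hlr hr₀ hS₀ hw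
  · exfalso
    have e : evec r₀ ℓ - evec r₀ (r₀ + 1 - (ℓ + 1)) = rootBeta r₀ ℓ := by
      rw [evec_dual (by omega) (by omega), rootBeta]; abel
    have h3 : w ℓ = i₀ := by rw [← h1, hww]
    have h4 : w (ℓ + 1) = j₀ := by rw [← h2, hww]
    have h5 := hw.2 (ℓ + 1) (by omega) (by omega)
    refine hL.not_block_lt (p := ℓ) (q := r₀ + 1 - (ℓ + 1)) (by omega) hr₀ hw hww (by omega)
      (by omega) (by omega) (by omega) (by omega) (by omega) (by omega)
      (by rw [e]; exact Or.inr rfl) (fun h => ?_) (Or.inl (by omega))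
    rw [e] at h
    have := congrFun h (ℓ + 1)
    simp only [rootAlpha, rootBeta, evec, Pi.sub_apply, Pi.add_apply] at this
    grind
  · have hwl : w ℓ = j₀ := by rw [← h2, hww]
    have hgt : ∀ d i, 1 ≤ i → i + d = ℓ → n < w i := by
      intro d
      induction d with
      | zero => intro i _ h; simp only [add_zero] at h; rw [h, hwl]; exact hj
      | succ d ih =>
        intro i hi h
        have := ih (i + 1) (by omega) (by omega)
        have := hmono i hi (by omega)
        omega
    have hex : ∃ m, w (m + 1) ≤ r₀ - n := ⟨i₀ - 1, by rw [Nat.sub_add_cancel hi]; omega⟩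
    obtain ⟨n₁, hspec, hmin⟩ : ∃ m, w (m + 1) ≤ r₀ - n ∧ ∀ k < m, ¬ w (k + 1) ≤ r₀ - n :=
      by classical exact ⟨Nat.find hex, Nat.find_spec hex, fun k hk => Nat.find_min hex hk⟩
    have hn₁ : n₁ ≤ i₀ - 1 := by
      by_contra hc
      refine hmin (i₀ - 1) (by omega) ?_
      rw [Nat.sub_add_cancel hi]; omega
    have hle : ∀ d, n₁ + 1 + d ≤ ℓ → w (n₁ + 1 + d) ≤ r₀ - n := by
      intro d
      induction d with
      | zero => intro _; exact hspec
      | succ d ih =>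
        intro h
        have := ih (by omega)
        have := hmono (n₁ + 1 + d) (by omega) (by omega)
        rw [add_assoc] at this
        rw [← add_assoc] at *
        omega
    have hle' : ∀ i, n₁ < i → i ≤ ℓ → n < w i ∧ w i ≤ r₀ - n := fun i h h' => by
      have := hle (i - (n₁ + 1)) (by omega)
      rw [Nat.add_sub_cancel' (by omega)] at this
      exact ⟨hgt (ℓ - i) i (by omega) (by omega), this⟩
    have hfix : ∀ i, n < i → i ≤ ℓ → w i = i := fun i h h' => by
      by_contra hc
      have := hle' i (by omega) h'
      have := hmid i (by omega) (by omega) hc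
      omega
    refine ⟨n₁, by omega, fun i hi hin => ?_, fun i hi hin => ?_, i₀, by omega, hin, h1⟩
    · have h3 := hmin (i - 1) (by omega)
      rw [Nat.sub_add_cancel hi] at h3
      have := hlow i hi (by omega) (by omega)
      omega
    · have hb := hle' i hi (by omega)
      have hwi := hww i
      refine ⟨?_, ?_⟩
      · by_contra hc
        have := hfix (w i) hb.1 (by omega)
        omega
      · by_contra hc
        have h3 := hfix (r₀ + 1 - w i) (by omega) (by omega)
        have h4 := hw.2 (w i) (by omega) (by omega)
        omega

/-- full-group case (`G ≠ SO(2r)`).  If `w ∈ W` is in reduced form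
(hence standard form) and satisfies Hypothesis (L), then
`w = (1 r₀)(2 r₀−1)⋯(n₁ n₁')·(n₁+1 k_1)(k_1' (n₁+1)')⋯(n k_{n−n₁})(k_{n−n₁}' n')`
for some `0 ≤ n₁ < n` and `k_1,…,k_{n−n₁} ∈ {ℓ+1,…,(ℓ+1)'}`, with the listed
transpositions pairwise disjoint; moreover `k_j = (ℓ+1)'` for some `j`. -/
theorem stmt18 (r n ℓ r₀ : ℕ)
    (hn : 1 ≤ n) (hnl : n ≤ ℓ) (hlr : ℓ + 1 ≤ r)
    (hr₀ : r₀ = 2 * r ∨ r₀ = 2 * r + 1)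
    (S₀ : Set (ℕ → ℤ)) (hS₀ : S₀ ⊆ ShortLong r₀ n)
    (w : Equiv.Perm ℕ) (hw : MemW r r₀ False w)
    (hred : IsReducedForm r r₀ n False w)
    (hL : HypL r r₀ n ℓ S₀ w) :
    ∃ n₁, n₁ < n ∧ ∃ k : ℕ → ℕ,
      (∀ j, 1 ≤ j → j ≤ n - n₁ → ℓ + 1 ≤ k j ∧ k j ≤ r₀ - ℓ) ∧
      (∀ j j', 1 ≤ j → j ≤ n - n₁ → 1 ≤ j' → j' ≤ n - n₁ →
        (j ≠ j' → k j ≠ k j') ∧ k j ≠ r₀ + 1 - k j') ∧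
      (∃ j, 1 ≤ j ∧ j ≤ n - n₁ ∧ k j = r₀ - ℓ) ∧
      w = w0base r₀ n₁ *
        (((List.range (n - n₁)).map (fun j =>
          Equiv.swap (n₁ + 1 + j) (k (j + 1)) *
          Equiv.swap (r₀ - n₁ - j) (r₀ + 1 - k (j + 1)))).prod) := by
  obtain ⟨w₁, w₂, hst, rfl, -, rfl | ⟨h, -⟩⟩ := hred
  swap
  · exact h.elim
  simp only [mul_one] at *
  generalize w₁ = w at *
  obtain ⟨n₁, hn₁, hhigh, hmidv, i₀, hi₀, hi₀n, hwi₀⟩ :=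
    hL.structure_of_isStandardForm hn hnl hlr hr₀ hS₀ hst
  obtain ⟨hW, hsq, hlow, hmid⟩ := hst
  have hww : ∀ x, w (w x) = x := fun x => by
    rw [← Equiv.Perm.mul_apply, hsq, Equiv.Perm.one_apply]
  have inj : ∀ a b, w a = w b → a = b := fun a b h => w.injective h
  have hdual : ∀ i, 1 ≤ i → i ≤ r₀ → w (r₀ + 1 - i) = r₀ + 1 - w i := hW.2
  refine ⟨n₁, hn₁, fun j => w (n₁ + j), fun j hj hj' => hmidv _ (by omega) (by omega), ?_,
    ⟨i₀ - n₁, by omega, by omega, by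
      change w (n₁ + (i₀ - n₁)) = _
      rw [Nat.add_sub_cancel' hi₀.le, hwi₀]⟩, ?_⟩
  · intro j j' hj hjn hj' hjn'
    refine ⟨fun hne h => hne ?_, fun h => ?_⟩
    · have := inj _ _ h
      omega
    · change w (n₁ + j) = r₀ + 1 - w (n₁ + j') at h
      rw [← hdual _ (by omega) (by omega)] at h
      have := inj _ _ h
      omega
  let A : ℕ → ℕ → Prop := fun i x => x = i + 1 ∨ x = r₀ - i
  let B : ℕ → ℕ → Prop := fun j x => x = n₁ + 1 + j ∨ x = w (n₁ + 1 + j) ∨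
    x = r₀ - n₁ - j ∨ x = r₀ + 1 - w (n₁ + 1 + j)
  have wA : ∀ i < n₁, w (i + 1) = r₀ - i ∧ w (r₀ - i) = i + 1 := fun i hi => by
    have h1 := hhigh (i + 1) (by omega) (by omega)
    have h2 : w (i + 1) = r₀ - i := by omega
    exact ⟨h2, by rw [← h2, hww]⟩
  have wB : ∀ j < n - n₁, w (r₀ - n₁ - j) = r₀ + 1 - w (n₁ + 1 + j) ∧
      w (r₀ + 1 - w (n₁ + 1 + j)) = r₀ - n₁ - j ∧
      ℓ + 1 ≤ w (n₁ + 1 + j) ∧ w (n₁ + 1 + j) ≤ r₀ - ℓ := fun j hj => by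
    have h1 := hmidv (n₁ + 1 + j) (by omega) (by omega)
    have h2 := hdual (n₁ + 1 + j) (by omega) (by omega)
    rw [show r₀ + 1 - (n₁ + 1 + j) = r₀ - n₁ - j by omega] at h2
    exact ⟨h2, by rw [← h2, hww], h1⟩
  obtain ⟨P₁, P₂⟩ := prod_range_apply w (fun i => Equiv.swap (i + 1) (r₀ - i)) A n₁
    (by
      intro i hi x hx
      obtain ⟨h1, h2⟩ := wA i hi
      rcases hx with rfl | rfl
      · rw [h1, Equiv.swap_apply_left]
      · rw [h2, Equiv.swap_apply_right])
    (by
      intro i hi x hx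
      exact Equiv.swap_apply_of_ne_of_ne (fun h => hx (Or.inl h)) (fun h => hx (Or.inr h)))
    (by
      intro i hi x hx
      obtain ⟨h1, h2⟩ := wA i hi
      rcases hx with rfl | rfl
      · exact Or.inr h1
      · exact Or.inl h2)
    (by
      intro i hi j hj x hx hx'
      simp only [A] at hx hx'
      omega)
  obtain ⟨Q₁, Q₂⟩ := prod_range_apply w (fun j =>
      Equiv.swap (n₁ + 1 + j) (w (n₁ + (j + 1))) *
      Equiv.swap (r₀ - n₁ - j) (r₀ + 1 - w (n₁ + (j + 1)))) B (n - n₁)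
    (by
      intro j hj x hx
      obtain ⟨h1, h2, h3, h4⟩ := wB j hj
      have h5 := hww (n₁ + 1 + j)
      have h6 : w (n₁ + 1 + j) ≠ r₀ + 1 - w (n₁ + 1 + j) := fun h => by
        rw [← h1] at h
        have := inj _ _ h
        omega
      rw [show n₁ + (j + 1) = n₁ + 1 + j by omega, Equiv.Perm.mul_apply]
      simp only [Equiv.swap_apply_def]
      rcases hx with rfl | rfl | rfl | rfl
      · split_ifs <;> omega
      · rw [h5]; split_ifs <;> omega
      · rw [h1]; split_ifs <;> omega
      · rw [h2]; split_ifs <;> omega)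
    (by
      intro j hj x hx
      simp only [B, not_or] at hx
      rw [show n₁ + (j + 1) = n₁ + 1 + j by omega, Equiv.Perm.mul_apply,
        Equiv.swap_apply_of_ne_of_ne hx.2.2.1 hx.2.2.2, Equiv.swap_apply_of_ne_of_ne hx.1 hx.2.1])
    (by
      intro j hj x hx
      obtain ⟨h1, h2, h3, h4⟩ := wB j hj
      rcases hx with rfl | rfl | rfl | rfl
      · exact Or.inr (Or.inl rfl)
      · exact Or.inl (hww _)
      · exact Or.inr (Or.inr (Or.inr h1))
      · exact Or.inr (Or.inr (Or.inl h2)))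
    (by
      intro i hi j hj x hx hx'
      obtain ⟨i1, i2, i3, i4⟩ := wB i hi
      obtain ⟨j1, j2, j3, j4⟩ := wB j hj
      have e1 := inj (n₁ + 1 + i) (n₁ + 1 + j)
      have e2 := inj (n₁ + 1 + i) (r₀ - n₁ - j)
      simp only [B] at hx hx'
      omega)
  have hAB : ∀ x, (∃ i < n₁, A i x) → ¬ ∃ j < n - n₁, B j x := by
    rintro x ⟨i, hi, hx⟩ ⟨j, hj, hx'⟩
    obtain ⟨h1, h2, h3, h4⟩ := wB j hj
    simp only [A, B] at hx hx'
    omega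
  have hBinv : ∀ x, (∃ j < n - n₁, B j x) → ∃ j < n - n₁, B j (w x) := by
    rintro x ⟨j, hj, hx⟩
    obtain ⟨h1, h2, h3, h4⟩ := wB j hj
    refine ⟨j, hj, ?_⟩
    rcases hx with rfl | rfl | rfl | rfl
    · exact Or.inr (Or.inl rfl)
    · exact Or.inl (hww _)
    · exact Or.inr (Or.inr (Or.inr h1))
    · exact Or.inr (Or.inr (Or.inl h2))
  have hA_of : ∀ x, 1 ≤ x → x ≤ n₁ → A (x - 1) x ∧ A (x - 1) (r₀ + 1 - x) := by
    intro x h1 h2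
    simp only [A]
    omega
  have hB_of : ∀ x, n₁ < x → x ≤ n → B (x - (n₁ + 1)) x ∧ B (x - (n₁ + 1)) (w x) ∧
      B (x - (n₁ + 1)) (r₀ + 1 - x) ∧ B (x - (n₁ + 1)) (r₀ + 1 - w x) := by
    intro x h1 h2
    simp only [B]
    rw [show n₁ + 1 + (x - (n₁ + 1)) = x by omega]
    omega
  have hlow_cov : ∀ x, 1 ≤ x → x ≤ n → ((∃ i < n₁, A i x) ∨ ∃ j < n - n₁, B j x) ∧
      ((∃ i < n₁, A i (r₀ + 1 - x)) ∨ ∃ j < n - n₁, B j (r₀ + 1 - x)) := by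
    intro x h1 h2
    by_cases h3 : x ≤ n₁
    · exact ⟨Or.inl ⟨_, by omega, (hA_of x h1 h3).1⟩, Or.inl ⟨_, by omega, (hA_of x h1 h3).2⟩⟩
    · have h4 := hB_of x (by omega) h2
      exact ⟨Or.inr ⟨_, by omega, h4.1⟩, Or.inr ⟨_, by omega, h4.2.2.1⟩⟩
  have hrest : ∀ x, (¬ ∃ i < n₁, A i x) → (¬ ∃ j < n - n₁, B j x) → w x = x := by
    intro x hx hx'
    by_cases h1 : 1 ≤ x ∧ x ≤ r₀
    swap
    · exact hW.1 x h1
    have c1 : ¬ x ≤ n := fun h => ((hlow_cov x h1.1 h).1).elim hx hx'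
    have c2 : x ≤ r₀ - n := by
      by_contra h
      have := (hlow_cov (r₀ + 1 - x) (by omega) (by omega)).2
      rw [show r₀ + 1 - (r₀ + 1 - x) = x by omega] at this
      exact this.elim hx hx'
    by_contra hne
    have key : ∀ y, 1 ≤ y → y ≤ n → w y ≠ x ∧ r₀ + 1 - w y ≠ x := by
      intro y hy hyn
      by_cases h3 : y ≤ n₁
      · have := hhigh y hy h3
        omega
      · have h4 := hB_of y (by omega) hyn
        exact ⟨fun h => hx' ⟨y - (n₁ + 1), by omega, h ▸ h4.2.1⟩,
          fun h => hx' ⟨y - (n₁ + 1), by omega, h ▸ h4.2.2.2⟩⟩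
    have hr := hW.mem_range h1.1 h1.2
    rcases hmid x (by omega) c2 hne with h | h
    · exact (key _ hr.1 h).1 (hww x)
    · refine (key (r₀ + 1 - w x) (by omega) (by omega)).2 ?_
      rw [hdual _ hr.1 hr.2, hww]
      omega
  ext x
  rw [Equiv.Perm.mul_apply, w0base]
  by_cases hB : ∃ j < n - n₁, B j x
  · rw [Q₁ x hB, P₂ (w x) fun h => hAB _ h (hBinv x hB)]
  · rw [Q₂ x hB]
    by_cases hA : ∃ i < n₁, A i x
    · rw [P₁ x hA]
    · rw [P₂ x hA, hrest x hA hB]
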